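/- Let 𝔤 = 𝒜₄,₁ be the 4-dimensional real Lie algebra with brackets [e₂,e₄] = e₁ and [e₃,e₄] = e₂. Then for every inner product g on 𝔤 and every alternating 2-form F on 𝔤 such that (g,F) is a solution of the Einstein–Maxwell equations, the metric g is Einstein. In other words, 𝒜₄,₁ admits no left-invariant non-Einstein solution to the Einstein–Maxwell equations. -/

import Mathlib

open scoped BigOperators

noncomputable section

/-- The underlying vector space `ℝ⁴` of the 4-dimensional Lie algebra. -/
abbrev V4 : Type := Fin 4 → ℝ

/-- The standard basis `e₁, e₂, e₃, e₄` (0-indexed). -/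
def ee (i : Fin 4) : V4 := Pi.single i 1

/-- `g` is an inner product: a positive-definite symmetric bilinear form. -/
structure IsInnerProduct (g : V4 → V4 → ℝ) : Prop where
  symm : ∀ x y, g x y = g y x
  add_left : ∀ x y z, g (x + y) z = g x z + g y z
  smul_left : ∀ (a : ℝ) (x y : V4), g (a • x) y = a * g x y
  pos : ∀ x : V4, x ≠ 0 → 0 < g x x

/-- `F` is an alternating bilinear 2-form. -/
structure IsAltForm (F : V4 → V4 → ℝ) : Prop where
  skew : ∀ x y, F x y = - F y x
  add_left : ∀ x y z, F (x + y) z = F x z + F y z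
  smul_left : ∀ (a : ℝ) (x y : V4), F (a • x) y = a * F x y

/-- Chevalley–Eilenberg differential of a 2-form with respect to the bracket `br`:
`dF(x,y,z) = −F([x,y],z) + F([x,z],y) − F([y,z],x)`. -/
def cdiff (br : V4 → V4 → V4) (F : V4 → V4 → ℝ) (x y z : V4) : ℝ :=
  - F (br x y) z + F (br x z) y - F (br y z) x

/-- A 2-form is closed if its Chevalley–Eilenberg differential vanishes. -/
def IsClosedForm (br : V4 → V4 → V4) (F : V4 → V4 → ℝ) : Prop :=
  ∀ x y z, cdiff br F x y z = 0

/-- The Gram matrix of a bilinear form in the standard basis. -/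
def gram (g : V4 → V4 → ℝ) : Matrix (Fin 4) (Fin 4) ℝ :=
  Matrix.of fun i j => g (ee i) (ee j)

/-- The inverse Gram matrix. -/
def ginv (g : V4 → V4 → ℝ) : Matrix (Fin 4) (Fin 4) ℝ := (gram g)⁻¹

/-- The inner product induced by `g` on 2-forms:
`⟨α,β⟩ = (1/2) Σ g^{ik} g^{jl} α_{ij} β_{kl}`. -/
def formInner (g : V4 → V4 → ℝ) (α β : V4 → V4 → ℝ) : ℝ :=
  (1 / 2) * ∑ i, ∑ j, ∑ k, ∑ l,
    ginv g i k * ginv g j l * α (ee i) (ee j) * β (ee k) (ee l)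

/-- The volume form of `g` for the orientation `e¹∧e²∧e³∧e⁴`. -/
def vol (g : V4 → V4 → ℝ) (x y z w : V4) : ℝ :=
  Real.sqrt (gram g).det * Matrix.det (Matrix.of fun i j => ![x, y, z, w] i j)

/-- The wedge product of two 2-forms, as a 4-form. -/
def wedge22 (α β : V4 → V4 → ℝ) (x y z w : V4) : ℝ :=
  α x y * β z w - α x z * β y w + α x w * β y z
    + α z w * β x y - α y w * β x z + α y z * β x w

/-- `sF` is the Hodge star `⋆F` of `F` with respect to `g` and the orientation
`e¹∧e²∧e³∧e⁴`: it is the 2-form with `α ∧ sF = ⟨α,F⟩_g vol_g` for all 2-forms `α`. -/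
def IsHodgeStar (g : V4 → V4 → ℝ) (F sF : V4 → V4 → ℝ) : Prop :=
  IsAltForm sF ∧
    ∀ α : V4 → V4 → ℝ, IsAltForm α → ∀ x y z w,
      wedge22 α sF x y z w = formInner g α F * vol g x y z w

/-- `F` is co-closed: `d(⋆F) = 0`. -/
def IsCoclosed (br : V4 → V4 → V4) (g F : V4 → V4 → ℝ) : Prop :=
  ∃ sF, IsHodgeStar g F sF ∧ IsClosedForm br sF

/-- Koszul expression: `g(∇ₓy, z) = (1/2)(g([x,y],z) − g([y,z],x) + g([z,x],y))`. -/
def koszul (br : V4 → V4 → V4) (g : V4 → V4 → ℝ) (x y z : V4) : ℝ :=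
  (1 / 2) * (g (br x y) z - g (br y z) x + g (br z x) y)

/-- The Levi-Civita product `∇ₓ y`, i.e. the unique vector with
`g(∇ₓy, z) = koszul x y z` for all `z` (computed via the inverse Gram matrix). -/
def LC (br : V4 → V4 → V4) (g : V4 → V4 → ℝ) (x y : V4) : V4 :=
  fun m => ∑ k, koszul br g x y (ee k) * ginv g k m

/-- Curvature `R(x,y)z = ∇ₓ∇_y z − ∇_y∇ₓ z − ∇_{[x,y]} z`. -/
def curv (br : V4 → V4 → V4) (g : V4 → V4 → ℝ) (x y z : V4) : V4 :=
  LC br g x (LC br g y z) - LC br g y (LC br g x z) - LC br g (br x y) z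

/-- Ricci tensor `Ric(x,y) = Σᵢ g(R(vᵢ,x)y, vᵢ)` for a `g`-orthonormal basis `(vᵢ)`,
i.e. the trace of the endomorphism `z ↦ R(z,x)y`. -/
def ricci (br : V4 → V4 → V4) (g : V4 → V4 → ℝ) (x y : V4) : ℝ :=
  ∑ i, curv br g (ee i) x y i

/-- Scalar curvature: the `g`-trace of the Ricci tensor. -/
def scal (br : V4 → V4 → V4) (g : V4 → V4 → ℝ) : ℝ :=
  ∑ a, ∑ b, ginv g a b * ricci br g (ee a) (ee b)

/-- Trace-free Ricci tensor `Ric₀ = Ric − (s/4) g`. -/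
def ricci0 (br : V4 → V4 → V4) (g : V4 → V4 → ℝ) (x y : V4) : ℝ :=
  ricci br g x y - (scal br g / 4) * g x y

/-- `g` is Einstein: `Ric₀ = 0`. -/
def IsEinstein (br : V4 → V4 → V4) (g : V4 → V4 → ℝ) : Prop :=
  ∀ x y, ricci0 br g x y = 0

/-- The endomorphism `F̂` with `g(F̂x, y) = F(x,y)` (computed via the inverse Gram matrix). -/
def fhat (g F : V4 → V4 → ℝ) (x : V4) : V4 :=
  fun m => ∑ k, F x (ee k) * ginv g k m

/-- `[F∘F]₀(x,y) = g(F̂(F̂x), y) − (1/4) tr(F̂∘F̂) g(x,y)`. -/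
def FF0 (g F : V4 → V4 → ℝ) (x y : V4) : ℝ :=
  g (fhat g F (fhat g F x)) y
    - (1 / 4) * (∑ i, fhat g F (fhat g F (ee i)) i) * g x y

/-- `(g, F)` is a solution of the Einstein--Maxwell equations:
`dF = 0`, `d(⋆F) = 0`, and `Ric₀ = −[F∘F]₀`. -/
def IsEMSolution (br : V4 → V4 → V4) (g F : V4 → V4 → ℝ) : Prop :=
  IsClosedForm br F ∧ IsCoclosed br g F ∧ ∀ x y, ricci0 br g x y = - FF0 g F x y

/-- Nijenhuis tensor `N_J(x,y) = [Jx,Jy] − J[Jx,y] − J[x,Jy] − [x,y]`. -/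
def nijenhuis (br : V4 → V4 → V4) (J : V4 →ₗ[ℝ] V4) (x y : V4) : V4 :=
  br (J x) (J y) - J (br (J x) y) - J (br x (J y)) - br x y

/-- The Lie algebra `𝒜₄,₁`: `[e₂,e₄] = e₁`, `[e₃,e₄] = e₂`. -/
def brA41 : V4 → V4 → V4 := fun x y =>
  (x 1 * y 3 - x 3 * y 1) • ee 0 + (x 2 * y 3 - x 3 * y 2) • ee 1

theorem IsInnerProduct.isLinearMap_right {g : V4 → V4 → ℝ} (hg : IsInnerProduct g) (x : V4) :
    IsLinearMap ℝ (g x) where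
  map_add y z := by rw [hg.symm, hg.add_left, hg.symm y, hg.symm z]
  map_smul a y := by rw [hg.symm, hg.smul_left, hg.symm y, smul_eq_mul]

theorem IsInnerProduct.isLinearMap_left {g : V4 → V4 → ℝ} (hg : IsInnerProduct g) (y : V4) :
    IsLinearMap ℝ (fun x => g x y) where
  map_add x z := hg.add_left x z y
  map_smul a x := hg.smul_left a x y

theorem IsAltForm.isLinearMap_left {F : V4 → V4 → ℝ} (hF : IsAltForm F) (y : V4) :
    IsLinearMap ℝ (fun x => F x y) where
  map_add x z := hF.add_left x z y
  map_smul a x := hF.smul_left a x y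

theorem IsAltForm.isLinearMap_right {F : V4 → V4 → ℝ} (hF : IsAltForm F) (x : V4) :
    IsLinearMap ℝ (F x) where
  map_add y z := by rw [hF.skew, hF.add_left, hF.skew y, hF.skew z]; ring
  map_smul a y := by rw [hF.skew, hF.smul_left, hF.skew y, smul_eq_mul]; ring

theorem IsAltForm.self {F : V4 → V4 → ℝ} (hF : IsAltForm F) (x : V4) : F x x = 0 := by
  have := hF.skew x x
  linarith

theorem IsLinearMap.map_sum_smul {M ι : Type*} [AddCommGroup M] [Module ℝ M] [Fintype ι]
    {f : V4 → M} (hf : IsLinearMap ℝ f) (c : ι → ℝ) (v : ι → V4) :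
    f (∑ i, c i • v i) = ∑ i, c i • f (v i) := by
  have h := map_sum (hf.mk' f) (fun i => c i • v i) Finset.univ
  simp only [IsLinearMap.mk'_apply, hf.map_smul] at h
  exact h

theorem V4.eq_sum_smul_ee (x : V4) : x = ∑ i, x i • ee i := by
  ext j
  simp [ee, Finset.sum_apply, Pi.single_apply]

theorem IsLinearMap.apply_eq_sum {M : Type*} [AddCommGroup M] [Module ℝ M] {f : V4 → M}
    (hf : IsLinearMap ℝ f) (x : V4) : f x = ∑ i, x i • f (ee i) := by
  conv_lhs => rw [V4.eq_sum_smul_ee x]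
  exact hf.map_sum_smul _ _

theorem gram_posDef {g : V4 → V4 → ℝ} (hg : IsInnerProduct g) : (gram g).PosDef := by
  refine Matrix.PosDef.of_dotProduct_mulVec_pos ?_ ?_
  · ext i j
    simp [gram, hg.symm (ee i)]
  · intro x hx
    have h := hg.pos x hx
    rw [(hg.isLinearMap_left x).apply_eq_sum] at h
    simp only [(hg.isLinearMap_right _).apply_eq_sum x, smul_eq_mul] at h
    simpa [dotProduct, Matrix.mulVec, gram, mul_comm] using h

/-- A frame that is orthonormal for `g`. -/
def IsOrthonormalFrame (g : V4 → V4 → ℝ) (v : Fin 4 → V4) : Prop :=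
  ∀ i j, g (v i) (v j) = if i = j then 1 else 0

/-- Gram–Schmidt: an orthonormal frame adapted to the standard flag. -/
theorem exists_triangular_orthonormalFrame {g : V4 → V4 → ℝ} (hg : IsInnerProduct g) :
    ∃ v : Fin 4 → V4, IsOrthonormalFrame g v ∧ (∀ i j, i < j → v i j = 0) ∧
      ∀ i, v i i ≠ 0 := by
  have hS := gram_posDef hg
  set P := LDL.lowerInv hS with hP
  have htri : ∀ i j, i < j → P i j = 0 := fun i j h => LDL.lowerInv_triangular hS h
  have hdet : P.det ≠ 0 := by
    have := LDL.invertibleLowerInv hS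
    exact (Matrix.isUnit_det_of_invertible P).ne_zero
  have hdiag : ∀ i, P i i ≠ 0 := by
    rw [Matrix.det_of_isLowerTriangular P (fun i j h => htri i j h)] at hdet
    exact fun i => Finset.prod_ne_zero_iff.mp hdet i (Finset.mem_univ i)
  have hpos : ∀ i, 0 < g (P i) (P i) := fun i =>
    hg.pos _ fun h => hdiag i (congrFun h i)
  have horth : ∀ i j, i ≠ j → g (P i) (P j) = 0 := by
    intro i j hij
    have h := congrFun (congrFun (LDL.diag_eq_lowerInv_conj hS) i) j
    rw [← hP, LDL.diag, Matrix.diagonal_apply_ne _ hij] at h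
    rw [(hg.isLinearMap_right _).apply_eq_sum]
    simp only [(hg.isLinearMap_left _).apply_eq_sum (P i)]
    rw [h]
    simp [Matrix.mul_apply, gram, mul_comm]
  have hsq : ∀ i, Real.sqrt (g (P i) (P i)) ≠ 0 := fun i => (Real.sqrt_pos.mpr (hpos i)).ne'
  refine ⟨fun i => (Real.sqrt (g (P i) (P i)))⁻¹ • P i, ?_, ?_, ?_⟩
  · intro i j
    rw [hg.smul_left, (hg.isLinearMap_right _).map_smul, smul_eq_mul]
    split_ifs with h
    · subst h
      have h1 := hsq i
      have h2 := Real.mul_self_sqrt (hpos i).le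
      field_simp
      linarith
    · rw [horth i j h]; simp
  · intro i j h
    simp [htri i j h]
  · intro i
    simp [hsq i, hdiag i]

namespace IsOrthonormalFrame

variable {g : V4 → V4 → ℝ} {v : Fin 4 → V4}

theorem mul_gram_mul_transpose (hv : IsOrthonormalFrame g v) (hg : IsInnerProduct g) :
    Matrix.of v * gram g * (Matrix.of v).transpose = 1 := by
  ext i j
  rw [Matrix.one_apply, ← hv i j, (hg.isLinearMap_right _).apply_eq_sum]
  simp only [(hg.isLinearMap_left _).apply_eq_sum (v i)]
  simp [Matrix.mul_apply, gram, mul_comm]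

theorem gram_mul (hv : IsOrthonormalFrame g v) (hg : IsInnerProduct g) :
    gram g * ((Matrix.of v).transpose * Matrix.of v) = 1 := by
  have h := hv.mul_gram_mul_transpose hg
  rw [Matrix.mul_assoc, mul_eq_one_comm, Matrix.mul_assoc] at h
  exact h

theorem ginv_eq (hv : IsOrthonormalFrame g v) (hg : IsInnerProduct g) :
    ginv g = (Matrix.of v).transpose * Matrix.of v :=
  Matrix.inv_eq_right_inv (hv.gram_mul hg)

theorem ginv_apply (hv : IsOrthonormalFrame g v) (hg : IsInnerProduct g) (k m : Fin 4) :
    ginv g k m = ∑ i, v i k * v i m := by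
  simp [hv.ginv_eq hg, Matrix.mul_apply]

theorem raise_eq (hv : IsOrthonormalFrame g v) (hg : IsInnerProduct g) {f : V4 → ℝ}
    (hf : IsLinearMap ℝ f) : (fun m => ∑ k, f (ee k) * ginv g k m) = ∑ i, f (v i) • v i := by
  ext m
  simp only [hv.ginv_apply hg, hf.apply_eq_sum (v _), Finset.sum_apply, Pi.smul_apply,
    smul_eq_mul, Finset.mul_sum, Finset.sum_mul]
  rw [Finset.sum_comm]
  exact Finset.sum_congr rfl fun _ _ => Finset.sum_congr rfl fun _ _ => by ring

theorem sum_ginv_mul (hv : IsOrthonormalFrame g v) (hg : IsInnerProduct g) (x : V4)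
    (m : Fin 4) : ∑ k, g (ee k) x * ginv g k m = x m := by
  have h : (ginv g * gram g) = 1 := by
    rw [hv.ginv_eq hg, mul_eq_one_comm]; exact hv.gram_mul hg
  simp only [(hg.isLinearMap_right _).apply_eq_sum x, Finset.sum_mul, smul_eq_mul]
  rw [Finset.sum_comm]
  have h' : gram g * ginv g = 1 := by rw [mul_eq_one_comm]; exact h
  have hi : ∀ i, ∑ k, g (ee i) (ee k) * ginv g k m = if i = m then 1 else 0 := fun i => by
    rw [← Matrix.one_apply, ← h', Matrix.mul_apply]; rfl
  calc _ = ∑ i, x i * ∑ k, g (ee i) (ee k) * ginv g k m := by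
        refine Finset.sum_congr rfl fun i _ => ?_
        rw [Finset.mul_sum]
        exact Finset.sum_congr rfl fun k _ => by rw [hg.symm (ee k)]; ring
    _ = x m := by simp [hi]

theorem eq_sum_smul (hv : IsOrthonormalFrame g v) (hg : IsInnerProduct g) (x : V4) :
    x = ∑ i, g x (v i) • v i := by
  rw [← hv.raise_eq hg (hg.isLinearMap_right x)]
  ext m
  simp only [hg.symm x]
  exact (hv.sum_ginv_mul hg x m).symm

theorem sum_smul_apply (hv : IsOrthonormalFrame g v) (hg : IsInnerProduct g) (c : Fin 4 → ℝ)
    (j : Fin 4) : g (∑ i, c i • v i) (v j) = c j := by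
  rw [(hg.isLinearMap_left (v j)).map_sum_smul]
  simp [hv _ j]

theorem trace_eq (hv : IsOrthonormalFrame g v) (hg : IsInnerProduct g) {T : V4 → V4}
    (hT : IsLinearMap ℝ T) : ∑ i, T (ee i) i = ∑ j, g (T (v j)) (v j) := by
  have h : ∀ i, T (ee i) i = ∑ j, g (ee i) (v j) * T (v j) i := fun i => by
    conv_lhs => rw [hv.eq_sum_smul hg (ee i), hT.map_sum_smul]
    simp
  simp only [h]
  rw [Finset.sum_comm]
  refine Finset.sum_congr rfl fun j _ => ?_
  rw [(hg.isLinearMap_left (v j)).apply_eq_sum (T (v j))]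
  simp [mul_comm]

theorem fhat_eq (hv : IsOrthonormalFrame g v) (hg : IsInnerProduct g) {F : V4 → V4 → ℝ}
    (hF : IsAltForm F) (x : V4) : fhat g F x = ∑ i, F x (v i) • v i :=
  hv.raise_eq hg (hF.isLinearMap_right x)

theorem apply_fhat_fhat (hv : IsOrthonormalFrame g v) (hg : IsInnerProduct g)
    {F : V4 → V4 → ℝ} (hF : IsAltForm F) (i : Fin 4) :
    g (fhat g F (fhat g F (v i))) (v i) = - ∑ k, F (v i) (v k) ^ 2 := by
  rw [hv.fhat_eq hg hF (fhat g F (v i)), hv.sum_smul_apply hg, hv.fhat_eq hg hF,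
    (hF.isLinearMap_left (v i)).map_sum_smul, ← Finset.sum_neg_distrib]
  refine Finset.sum_congr rfl fun k _ => ?_
  rw [hF.skew (v k), smul_eq_mul]
  ring

end IsOrthonormalFrame

theorem sum_rotate {ι : Type*} [Fintype ι] (f : ι → ι → ι → ℝ) :
    ∑ i, ∑ j, ∑ k, f i j k = ∑ j, ∑ k, ∑ i, f i j k := by
  rw [Finset.sum_comm]
  exact Finset.sum_congr rfl fun j _ => Finset.sum_comm

/-- The decomposable 2-form `x♭ ∧ y♭`. -/
def flatWedge (g : V4 → V4 → ℝ) (u w : V4) : V4 → V4 → ℝ :=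
  fun x y => g x u * g y w - g x w * g y u

theorem isAltForm_flatWedge {g : V4 → V4 → ℝ} (hg : IsInnerProduct g) (u w : V4) :
    IsAltForm (flatWedge g u w) where
  skew x y := by simp only [flatWedge]; ring
  add_left x y z := by simp only [flatWedge, hg.add_left]; ring
  smul_left a x y := by simp only [flatWedge, hg.smul_left]; ring

theorem IsOrthonormalFrame.formInner_flatWedge {g : V4 → V4 → ℝ} {v : Fin 4 → V4}
    (hv : IsOrthonormalFrame g v) (hg : IsInnerProduct g) {F : V4 → V4 → ℝ}
    (hF : IsAltForm F) (u w : V4) : formInner g (flatWedge g u w) F = F u w := by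
  have key : ∀ p q : V4, ∑ i, ∑ j, ∑ k, ∑ l,
      (g (ee i) p * ginv g i k) * (g (ee j) q * ginv g j l) * F (ee k) (ee l) = F p q := by
    intro p q
    calc _ = ∑ k, ∑ l, (∑ i, g (ee i) p * ginv g i k) * (∑ j, g (ee j) q * ginv g j l)
          * F (ee k) (ee l) := by
          simp only [Finset.sum_mul_sum]
          simp only [Finset.sum_mul]
          exact (Finset.sum_congr rfl fun i _ => sum_rotate _).trans (sum_rotate _)
      _ = F p q := by
          simp only [hv.sum_ginv_mul hg]
          rw [(hF.isLinearMap_left q).apply_eq_sum p]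
          simp only [(hF.isLinearMap_right _).apply_eq_sum q, smul_eq_mul,
            Finset.mul_sum, mul_assoc]
  have h : formInner g (flatWedge g u w) F = (1 / 2) * (F u w - F w u) := by
    rw [← key u w, ← key w u, formInner]
    simp only [← Finset.sum_sub_distrib]
    congr 1
    refine Finset.sum_congr rfl fun i _ => Finset.sum_congr rfl fun j _ =>
      Finset.sum_congr rfl fun k _ => Finset.sum_congr rfl fun l _ => ?_
    simp only [flatWedge]
    ring
  rw [h, hF.skew w u]
  ring

theorem IsOrthonormalFrame.vol_ne_zero {g : V4 → V4 → ℝ} {v : Fin 4 → V4}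
    (hv : IsOrthonormalFrame g v) (hg : IsInnerProduct g) :
    vol g (v 0) (v 1) (v 2) (v 3) ≠ 0 := by
  have h := congrArg Matrix.det (hv.mul_gram_mul_transpose hg)
  rw [Matrix.det_mul, Matrix.det_mul, Matrix.det_one] at h
  have hvec : (Matrix.of fun i j => ![v 0, v 1, v 2, v 3] i j) = Matrix.of v := by
    ext i j
    fin_cases i <;> rfl
  rw [vol, hvec]
  refine mul_ne_zero (Real.sqrt_pos.mpr (gram_posDef hg).det_pos).ne' fun h0 => ?_
  simp [h0] at h

/-- Bilinearity of a bracket. -/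
structure IsBilinearBracket (br : V4 → V4 → V4) : Prop where
  left : ∀ y, IsLinearMap ℝ (fun x => br x y)
  right : ∀ x, IsLinearMap ℝ (br x)

theorem isBilinearBracket_brA41 : IsBilinearBracket brA41 where
  left y :=
    { map_add := fun x z => by
        simp only [brA41, Pi.add_apply, add_mul]; module
      map_smul := fun a x => by
        simp only [brA41, Pi.smul_apply, smul_eq_mul]; module }
  right x :=
    { map_add := fun y z => by
        simp only [brA41, Pi.add_apply, mul_add]; module
      map_smul := fun a y => by
        simp only [brA41, Pi.smul_apply, smul_eq_mul]; module }

section LeviCivita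

variable {g : V4 → V4 → ℝ} {br : V4 → V4 → V4}

theorem isLinearMap_koszul_left (hg : IsInnerProduct g) (hb : IsBilinearBracket br) (y z : V4) :
    IsLinearMap ℝ (fun x => koszul br g x y z) where
  map_add a b := by
    simp only [koszul, (hb.left _).map_add, (hb.right _).map_add, hg.add_left,
      (hg.isLinearMap_right _).map_add]
    ring
  map_smul c a := by
    simp only [koszul, (hb.left _).map_smul, (hb.right _).map_smul, hg.smul_left,
      (hg.isLinearMap_right _).map_smul, smul_eq_mul]
    ring

theorem isLinearMap_koszul_mid (hg : IsInnerProduct g) (hb : IsBilinearBracket br) (x z : V4) :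
    IsLinearMap ℝ (fun y => koszul br g x y z) where
  map_add a b := by
    simp only [koszul, (hb.left _).map_add, (hb.right _).map_add, hg.add_left,
      (hg.isLinearMap_right _).map_add]
    ring
  map_smul c a := by
    simp only [koszul, (hb.left _).map_smul, (hb.right _).map_smul, hg.smul_left,
      (hg.isLinearMap_right _).map_smul, smul_eq_mul]
    ring

theorem isLinearMap_koszul_right (hg : IsInnerProduct g) (hb : IsBilinearBracket br) (x y : V4) :
    IsLinearMap ℝ (koszul br g x y) where
  map_add a b := by
    simp only [koszul, (hb.left _).map_add, (hb.right _).map_add, hg.add_left,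
      (hg.isLinearMap_right _).map_add]
    ring
  map_smul c a := by
    simp only [koszul, (hb.left _).map_smul, (hb.right _).map_smul, hg.smul_left,
      (hg.isLinearMap_right _).map_smul, smul_eq_mul]
    ring

theorem isLinearMap_LC_left (hg : IsInnerProduct g) (hb : IsBilinearBracket br) (y : V4) :
    IsLinearMap ℝ (fun x => LC br g x y) where
  map_add a b := by
    ext m
    simp only [LC, (isLinearMap_koszul_left hg hb _ _).map_add, add_mul,
      Finset.sum_add_distrib, Pi.add_apply]
  map_smul c a := by
    ext m
    simp only [LC, (isLinearMap_koszul_left hg hb _ _).map_smul, smul_eq_mul, mul_assoc,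
      Finset.mul_sum, Pi.smul_apply]

theorem isLinearMap_LC_right (hg : IsInnerProduct g) (hb : IsBilinearBracket br) (x : V4) :
    IsLinearMap ℝ (LC br g x) where
  map_add a b := by
    ext m
    simp only [LC, (isLinearMap_koszul_mid hg hb _ _).map_add, add_mul,
      Finset.sum_add_distrib, Pi.add_apply]
  map_smul c a := by
    ext m
    simp only [LC, (isLinearMap_koszul_mid hg hb _ _).map_smul, smul_eq_mul, mul_assoc,
      Finset.mul_sum, Pi.smul_apply]

theorem isLinearMap_curv_left (hg : IsInnerProduct g) (hb : IsBilinearBracket br) (y z : V4) :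
    IsLinearMap ℝ (fun x => curv br g x y z) where
  map_add a b := by
    simp only [curv, (hb.left _).map_add, (isLinearMap_LC_left hg hb _).map_add,
      (isLinearMap_LC_right hg hb _).map_add]
    abel
  map_smul c a := by
    simp only [curv, (hb.left _).map_smul, (isLinearMap_LC_left hg hb _).map_smul,
      (isLinearMap_LC_right hg hb _).map_smul]
    module

theorem IsOrthonormalFrame.LC_eq {v : Fin 4 → V4} (hv : IsOrthonormalFrame g v)
    (hg : IsInnerProduct g) (hb : IsBilinearBracket br) (x y : V4) :
    LC br g x y = ∑ k, koszul br g x y (v k) • v k :=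
  hv.raise_eq hg (isLinearMap_koszul_right hg hb x y)

/-- The Ricci tensor in an orthonormal frame, through the Christoffel symbols of the frame. -/
theorem IsOrthonormalFrame.ricci_eq {v : Fin 4 → V4} (hv : IsOrthonormalFrame g v)
    (hg : IsInnerProduct g) (hb : IsBilinearBracket br) (j k : Fin 4) :
    ricci br g (v j) (v k) = ∑ i, ∑ m,
      (koszul br g (v j) (v k) (v m) * koszul br g (v i) (v m) (v i)
        - koszul br g (v i) (v k) (v m) * koszul br g (v j) (v m) (v i)
        - g (br (v i) (v j)) (v m) * koszul br g (v m) (v k) (v i)) := by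
  have hLC : ∀ x y l, g (LC br g x y) (v l) = koszul br g x y (v l) := fun x y l => by
    rw [hv.LC_eq hg hb, hv.sum_smul_apply hg]
  have hsub : ∀ x y z, g (x - y) z = g x z - g y z := fun x y z =>
    (hg.isLinearMap_left z).map_sub x y
  rw [ricci, hv.trace_eq hg (isLinearMap_curv_left hg hb _ _)]
  refine Finset.sum_congr rfl fun i _ => ?_
  simp only [curv, hsub, hLC, Finset.sum_sub_distrib]
  rw [hv.LC_eq hg hb (v j) (v k), hv.LC_eq hg hb (v i) (v k),
    (isLinearMap_koszul_mid hg hb _ _).map_sum_smul,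
    (isLinearMap_koszul_mid hg hb _ _).map_sum_smul]
  conv_lhs => rw [hv.eq_sum_smul hg (br (v i) (v j))]
  rw [(isLinearMap_koszul_left hg hb _ _).map_sum_smul]
  simp only [smul_eq_mul]

end LeviCivita

/-- A frame adapted to `𝒜₄,₁`: it has the brackets `[v₁,v₃] = a v₀` and
`[v₂,v₃] = c v₀ + b v₁`, and all others vanish. -/
structure IsAdaptedFrame (v : Fin 4 → V4) (a b c : ℝ) : Prop where
  ideal : ∀ i j, i ≠ 3 → j ≠ 3 → brA41 (v i) (v j) = 0
  self : ∀ x, brA41 x x = 0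
  br03 : brA41 (v 0) (v 3) = 0
  br13 : brA41 (v 1) (v 3) = a • v 0
  br23 : brA41 (v 2) (v 3) = c • v 0 + b • v 1
  br30 : brA41 (v 3) (v 0) = 0
  br31 : brA41 (v 3) (v 1) = (-a) • v 0
  br32 : brA41 (v 3) (v 2) = (-c) • v 0 + (-b) • v 1

theorem brA41_skew (x y : V4) : brA41 x y = -brA41 y x := by
  simp only [brA41]
  module

theorem exists_isAdaptedFrame {v : Fin 4 → V4} (ht : ∀ i j, i < j → v i j = 0)
    (hd : ∀ i, v i i ≠ 0) : ∃ a b c : ℝ, a ≠ 0 ∧ b ≠ 0 ∧ IsAdaptedFrame v a b c := by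
  have h01 := ht 0 1 (by decide)
  have h02 := ht 0 2 (by decide)
  have h03 := ht 0 3 (by decide)
  have h12 := ht 1 2 (by decide)
  have h13 := ht 1 3 (by decide)
  have h23 := ht 2 3 (by decide)
  have d0 := hd 0
  have d1 := hd 1
  have d2 := hd 2
  have d3 := hd 3
  have e03 : brA41 (v 0) (v 3) = 0 := by
    simp [brA41, h01, h02, h03]
  have e13 : brA41 (v 1) (v 3) = (v 1 1 * v 3 3 / v 0 0) • v 0 := by
    ext m
    fin_cases m <;> simp [brA41, ee, h01, h02, h03, h12, h13]
    field_simp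
  have e23 : brA41 (v 2) (v 3) =
      ((v 2 1 * v 3 3 - v 2 2 * v 3 3 / v 1 1 * v 1 0) / v 0 0) • v 0
        + (v 2 2 * v 3 3 / v 1 1) • v 1 := by
    ext m
    fin_cases m <;> simp [brA41, ee, h01, h02, h03, h12, h13, h23]
    all_goals field_simp
    ring
  refine ⟨_, _, _, div_ne_zero (mul_ne_zero d1 d3) d0, div_ne_zero (mul_ne_zero d2 d3) d1,
    ?_, ?_, e03, e13, e23, ?_, ?_, ?_⟩
  · intro i j hi hj
    have hi3 : v i 3 = 0 := ht i 3 (by omega)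
    have hj3 : v j 3 = 0 := ht j 3 (by omega)
    simp [brA41, hi3, hj3]
  · intro x
    simp only [brA41]
    module
  · rw [brA41_skew, e03, neg_zero]
  · rw [brA41_skew, e13, neg_smul]
  · rw [brA41_skew, e23, neg_add, neg_smul, neg_smul]

namespace IsAdaptedFrame

variable {g : V4 → V4 → ℝ} {v : Fin 4 → V4} {a b c : ℝ}

theorem closed_coeff (ha : IsAdaptedFrame v a b c) (ha0 : a ≠ 0) (hb0 : b ≠ 0)
    {F : V4 → V4 → ℝ} (hF : IsAltForm F) (hc : IsClosedForm brA41 F) :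
    F (v 0) (v 1) = 0 ∧ F (v 0) (v 2) = 0 := by
  have hz : ∀ y, F 0 y = 0 := fun y => (hF.isLinearMap_left y).map_zero
  have h1 := hc (v 0) (v 2) (v 3)
  have h2 := hc (v 1) (v 2) (v 3)
  simp only [cdiff, ha.ideal 0 2 (by decide) (by decide), ha.ideal 1 2 (by decide) (by decide),
    ha.br03, ha.br13, ha.br23, hz, hF.add_left, hF.smul_left, hF.self] at h1 h2
  have h01 : F (v 0) (v 1) = 0 := by
    rw [hF.skew (v 1) (v 0)] at h1
    exact (mul_eq_zero.mp (show b * F (v 0) (v 1) = 0 by linarith)).resolve_left hb0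
  refine ⟨h01, ?_⟩
  rw [h01] at h2
  exact (mul_eq_zero.mp (show a * F (v 0) (v 2) = 0 by linarith)).resolve_left ha0

theorem coclosed_coeff (ha : IsAdaptedFrame v a b c) (ha0 : a ≠ 0) (hb0 : b ≠ 0)
    (hg : IsInnerProduct g) (hv : IsOrthonormalFrame g v)
    {F : V4 → V4 → ℝ} (hF : IsAltForm F) (hc : IsCoclosed brA41 g F) :
    F (v 2) (v 3) = 0 ∧ F (v 1) (v 3) = 0 := by
  obtain ⟨sF, ⟨hsF, hstar⟩, hcl⟩ := hc
  obtain ⟨s01, s02⟩ := ha.closed_coeff ha0 hb0 hsF hcl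
  have hvol := hv.vol_ne_zero hg
  constructor
  · have h := hstar _ (isAltForm_flatWedge hg (v 2) (v 3)) (v 0) (v 1) (v 2) (v 3)
    rw [hv.formInner_flatWedge hg hF] at h
    simp only [wedge22, flatWedge, hv _ _] at h
    simp [s01] at h
    exact h.resolve_right hvol
  · have h := hstar _ (isAltForm_flatWedge hg (v 1) (v 3)) (v 0) (v 1) (v 2) (v 3)
    rw [hv.formInner_flatWedge hg hF] at h
    simp only [wedge22, flatWedge, hv _ _] at h
    simp [s02] at h
    exact h.resolve_right hvol

theorem ricci_zero_zero (ha : IsAdaptedFrame v a b c) (hg : IsInnerProduct g)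
    (hv : IsOrthonormalFrame g v) : ricci brA41 g (v 0) (v 0) = (a ^ 2 + c ^ 2) / 2 := by
  have hz : ∀ y, g 0 y = 0 := fun y => (hg.isLinearMap_left y).map_zero
  have hn : ∀ x y, g (-x) y = -g x y := fun x y => (hg.isLinearMap_left y).map_neg x
  rw [hv.ricci_eq hg isBilinearBracket_brA41]
  simp [Fin.sum_univ_four, koszul, ha.ideal, ha.self, ha.br03, ha.br13, ha.br23, ha.br30,
    ha.br31, ha.br32, hz, hn, hg.add_left, hg.smul_left, hv _ _]
  ring

theorem ricci_three_three (ha : IsAdaptedFrame v a b c) (hg : IsInnerProduct g)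
    (hv : IsOrthonormalFrame g v) :
    ricci brA41 g (v 3) (v 3) = -(a ^ 2 + b ^ 2 + c ^ 2) / 2 := by
  have hz : ∀ y, g 0 y = 0 := fun y => (hg.isLinearMap_left y).map_zero
  have hn : ∀ x y, g (-x) y = -g x y := fun x y => (hg.isLinearMap_left y).map_neg x
  rw [hv.ricci_eq hg isBilinearBracket_brA41]
  simp [Fin.sum_univ_four, koszul, ha.ideal, ha.self, ha.br03, ha.br13, ha.br23, ha.br30,
    ha.br31, ha.br32, hz, hn, hg.add_left, hg.smul_left, hv _ _]
  ring

end IsAdaptedFrame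

/-- `𝒜₄,₁` admits no left-invariant non-Einstein solution to the Einstein--Maxwell equations. -/
theorem stmt7 :
    ∀ g F : V4 → V4 → ℝ, IsInnerProduct g → IsAltForm F →
      IsEMSolution (brA41) g F → IsEinstein (brA41) g := by
  intro g F hg hF ⟨hcl, hco, hEM⟩
  obtain ⟨v, hv, ht, hd⟩ := exists_triangular_orthonormalFrame hg
  obtain ⟨a, b, c, ha0, hb0, ha⟩ := exists_isAdaptedFrame ht hd
  obtain ⟨h01, h02⟩ := ha.closed_coeff ha0 hb0 hF hcl
  obtain ⟨h23, h13⟩ := ha.coclosed_coeff ha0 hb0 hg hv hF hco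
  have h0 := hEM (v 0) (v 0)
  have h3 := hEM (v 3) (v 3)
  rw [ricci0, FF0, hv.apply_fhat_fhat hg hF, hv, Fin.sum_univ_four, hF.self, h01, h02,
    ha.ricci_zero_zero hg hv] at h0
  rw [ricci0, FF0, hv.apply_fhat_fhat hg hF, hv, Fin.sum_univ_four, hF.self,
    hF.skew (v 3) (v 0), hF.skew (v 3) (v 1), hF.skew (v 3) (v 2), h13, h23,
    ha.ricci_three_three hg hv] at h3
  simp only [if_true] at h0 h3
  have hpos : 0 < a ^ 2 := by positivity
  nlinarith [sq_nonneg b, sq_nonneg c]
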